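/- Let d = 3 and let p > 5 be a real number. Then there exists S > 0 and smooth functions M : Γ₃ → ℝ and E_{αβ} : Γ₃ → ℝ for α,β ∈ {0,1,2,3} with E_{αβ} = E_{βα}, such that: (i) M(e^S t, e^S x) = e^{−(4/(p−1))S} M(t,x) and E_{αβ}(e^S t, e^S x) = e^{−(2(p+1)/(p−1))S} E_{αβ}(t,x) on Γ₃; (ii) the defocusing condition (1/2)□M − (−E_{00} + ∑_{i=1}^{3} E_{ii}) > 0 holds throughout Γ₃; (iii) for each α ∈ {0,1,2,3}, ∂_α[(1/2)□M − (−E_{00} + ∑_{i=1}^{3} E_{ii})] = (p+1)[−∂_t E_{α0} + ∑_{i=1}^{3} ∂_{x_i} E_{αi} − (1/2)∂_α(−E_{00} + ∑_{i=1}^{3} E_{ii})], where ∂_0 := ∂_t and ∂_i := ∂_{x_i}; and (iv) at every point of Γ₃ the 5×5 symmetric matrix whose (0,0) entry is M, whose remaining entries in the zeroth row and column are (1/2)∂_t M, (1/2)∂_{x_1}M, (1/2)∂_{x_2}M, (1/2)∂_{x_3}M, and whose remaining (α,β) entries (α,β ∈ {0,1,2,3}, shifted by one) are E_{αβ}, is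 strictly positive definite. -/

import Mathlib

open Real MeasureTheory
open scoped RealInnerProductSpace

noncomputable section

/-- Spacetime `ℝ^{1+d}` realised as `Fin (d+1) → ℝ`; coordinate `0` is the time `t`,
coordinates `i.succ` are the spatial coordinates `x_i`. -/
abbrev Sp (d : ℕ) := Fin (d + 1) → ℝ

/-- The Euclidean target space `ℝ^m`. -/
abbrev Em (m : ℕ) := EuclideanSpace ℝ (Fin m)

/-- The coordinate partial derivative `∂_α`. -/
def pd {d : ℕ} {E : Type*} [NormedAddCommGroup E] [NormedSpace ℝ E]
    (α : Fin (d + 1)) (f : Sp d → E) : Sp d → E :=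
  fun x => fderiv ℝ f x (Pi.single α 1)

/-- The d'Alembertian `□ = -∂_t² + ∑_i ∂_{x_i}²`. -/
def dAlembert {d : ℕ} {E : Type*} [NormedAddCommGroup E] [NormedSpace ℝ E]
    (f : Sp d → E) : Sp d → E :=
  fun x => -(pd 0 (pd 0 f) x) + ∑ i : Fin d, pd i.succ (pd i.succ f) x

/-- The (truncated, solid) light cone `Γ_d = {(t,x) : t > 0, |x| ≤ t}`,
with `|x|` the Euclidean norm. -/
def Cone (d : ℕ) : Set (Sp d) :=
  {y | 0 < y 0 ∧ ∑ i : Fin d, (y i.succ) ^ 2 ≤ (y 0) ^ 2}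

/-- The `5×5` Gram-type matrix with `(0,0)` entry `M`, remaining zeroth row/column entries
`(1/2)∂_α M`, and lower-right `4×4` block `E_{αβ}`. -/
def bigMat (M : Sp 3 → ℝ) (E : Fin 4 → Fin 4 → Sp 3 → ℝ) (y : Sp 3) :
    Matrix (Fin 5) (Fin 5) ℝ :=
  Matrix.of fun i j =>
    if hi : i = 0 then
      (if hj : j = 0 then M y else (1 / 2) * pd (j.pred hj) M y)
    else
      (if hj : j = 0 then (1 / 2) * pd (i.pred hi) M y
       else E (i.pred hi) (j.pred hj) y)

/-- Real functions `e, g, b, h` of `R = |x|² / t²` such that the tensor with components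
`t ^ (-k-2) e`, `-t ^ (-k-3) g x_l`, `t ^ (-k-2) (b δ_lm + h x_l x_m / t ^ 2)`, together with the
scalar `ε t ^ (-k)`, satisfies the self-similar form of the divergence, trace and positivity
conditions. -/
structure Profile (p k ε v : ℝ) (e g b h e' g' b' h' : ℝ → ℝ) : Prop where
  smooth_e : ContDiff ℝ (⊤ : ℕ∞) e
  smooth_g : ContDiff ℝ (⊤ : ℕ∞) g
  smooth_b : ContDiff ℝ (⊤ : ℕ∞) b
  smooth_h : ContDiff ℝ (⊤ : ℕ∞) h
  deriv_e : ∀ R, HasDerivAt e (e' R) R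
  deriv_g : ∀ R, HasDerivAt g (g' R) R
  deriv_b : ∀ R, HasDerivAt b (b' R) R
  deriv_h : ∀ R, HasDerivAt h (h' R) R
  energy : ∀ R, (k + 2) * e R + 2 * R * e' R - 3 * g R - 2 * R * g' R =
    (k + 2) * (ε * k * (k + 1) / 4 + (p - 1) * v / 2)
  momentum : ∀ R, -(k + 3) * g R - 2 * R * g' R + 2 * b' R + 4 * h R + 2 * R * h' R = 0
  trace : ∀ R, -e R + 3 * b R + R * h R = -(ε * k * (k + 1) / 2 + (p + 1) * v)
  pos : ∀ R ξ N X : ℝ, 0 ≤ R → R ≤ 1 → X ^ 2 ≤ R * N → 0 ≤ N → (ξ ≠ 0 ∨ N ≠ 0) →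
    0 < (e R - ε * k ^ 2 / 4) * ξ ^ 2 - 2 * g R * ξ * X + b R * N + h R * X ^ 2

theorem hasDerivAt_quadrinomial (c₀ c₁ c₂ c₃ : ℝ) (i : ℕ) (R : ℝ) :
    HasDerivAt (fun R : ℝ => c₀ + c₁ * R + c₂ * R ^ (i + 1) + c₃ * R ^ (i + 2))
      (c₁ + c₂ * ((i + 1) * R ^ i) + c₃ * ((i + 2) * R ^ (i + 1))) R := by
  have h1 := (hasDerivAt_pow (i + 1) R).const_mul c₂
  have h2 := (hasDerivAt_pow (i + 2) R).const_mul c₃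
  have h3 := (hasDerivAt_id R).const_mul c₁
  refine (((h3.const_add c₀).add h1).add h2).congr_deriv ?_
  simp

/-- The part of the quadratic form coming from `e = 1`. -/
theorem base_form_lower_bound {k R ξ N X : ℝ} (hk0 : 0 ≤ k) (hk1 : k ≤ 1)
    (hX : X ^ 2 ≤ R * N) :
    N / 3 - X ^ 2 / 5 - 2 / 5 * (R * N - X ^ 2) ≤
      ξ ^ 2 - 2 * ((2 + k) / 3) * ξ * X
        + (1 / 3 - (1 - k * (1 - k) / 6 - (2 - k) * (3 - k) / 10) / 2 * R) * N
        + 3 / 2 * (1 - k * (1 - k) / 6 - (2 - k) * (3 - k) / 10) * X ^ 2 := by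
  have h1 : 0 ≤ (ξ - (2 + k) / 3 * X) ^ 2 := sq_nonneg _
  have h2 : 0 ≤ (6 - 5 * k - 2 * k ^ 2 + 1) * X ^ 2 := by
    nlinarith [mul_nonneg (mul_nonneg hk0 (sub_nonneg.2 hk1)) (sq_nonneg X),
      mul_nonneg (sub_nonneg.2 hk1) (sq_nonneg X)]
  have h3 : 0 ≤ (1 - k) * (12 + 2 * k) * (R * N - X ^ 2) :=
    mul_nonneg (mul_nonneg (by linarith) (by linarith)) (by linarith)
  nlinarith

/-- The part of the quadratic form coming from `e = R ^ (i + 2)`, concentrated at `R = 1`. -/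
theorem concentrated_form_lower_bound {k n q R ξ N X : ℝ} (i : ℕ) (hk0 : 0 ≤ k) (hk1 : k ≤ 1)
    (hn : n * (2 * i + 7) = 1) (hq : q * (2 * i + 9) = 1)
    (hR0 : 0 ≤ R) (hR1 : R ≤ 1) (hX : X ^ 2 ≤ R * N) :
    ((2 - k) * (3 - k) / 2 * q - n * (1 - k * (1 - k) / 2)) / 2 * R ^ (i + 1)
        * (R * N - X ^ 2) ≤
      R ^ (i + 2) * ξ ^ 2 - 2 * ((1 - (1 - k) * n) * R ^ (i + 2)) * ξ * X
        + ((1 - n) * R ^ (i + 2)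
          - (1 - n * k * (1 - k) / 2 - (2 - k) * (3 - k) / 2 * q) * R ^ (i + 3)) / 2 * N
        + ((3 * n - 1) / 2 * R ^ (i + 1)
          + 3 / 2 * (1 - n * k * (1 - k) / 2 - (2 - k) * (3 - k) / 2 * q) * R ^ (i + 2))
          * X ^ 2 := by
  have hi : (0 : ℝ) ≤ i := Nat.cast_nonneg i
  have hn0 : 0 < n := by
    by_contra h
    nlinarith [mul_nonneg (sub_nonneg.2 (not_lt.1 h)) hi]
  have hq0 : 0 < q := by
    by_contra h
    nlinarith [mul_nonneg (sub_nonneg.2 (not_lt.1 h)) hi]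
  have hn7 : n ≤ 1 / 7 := by nlinarith [mul_nonneg hn0.le hi]
  have hq9 : q ≤ 1 / 9 := by nlinarith [mul_nonneg hq0.le hi]
  have hnq : n - q = 2 * n * q := by linear_combination q * hn - n * hq
  set c := (2 - k) * (3 - k) / 2 with hc
  set β := 1 - n * k * (1 - k) / 2 - c * q with hβ
  set m := 1 - (1 - k) * n with hm
  have hc1 : 1 ≤ c := by rw [hc]; nlinarith
  have hc3 : c ≤ 3 := by rw [hc]; nlinarith
  have hβ0 : 0 ≤ β := by
    have h1 : c * q ≤ 3 * (1 / 9) := mul_le_mul hc3 hq9 hq0.le (by norm_num)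
    have h2 : n * (k * (1 - k)) ≤ 1 / 7 * 1 :=
      mul_le_mul hn7 (by nlinarith) (mul_nonneg hk0 (by linarith)) (by norm_num)
    rw [hβ]; nlinarith
  have hend : 0 ≤ n + (β - m ^ 2) := by
    have h1 : n + (β - m ^ 2) = n * (2 * c * q - (1 - k) ^ 2 * n) := by
      rw [hβ, hm, hc]; linear_combination (2 - k) * (3 - k) / 2 * hnq
    have h2 : (1 - k) ^ 2 ≤ 1 := by nlinarith
    have h3 : n ≤ 2 * q := by nlinarith
    have h4 : (1 - k) ^ 2 * n ≤ 1 * n := mul_le_mul_of_nonneg_right h2 hn0.le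
    have h5 : 2 * 1 * q ≤ 2 * c * q := by nlinarith
    rw [h1]
    exact mul_nonneg hn0.le (by linarith)
  have hrad : 0 ≤ n + (β - m ^ 2) * R := by nlinarith
  have hZ : 0 ≤ R ^ (i + 1) := pow_nonneg hR0 _
  have hC : 0 ≤ R * N - X ^ 2 := by linarith
  have e1 : 0 ≤ R ^ (i + 1) * (R * (ξ - m * X) ^ 2) := by positivity
  have e2 : 0 ≤ R ^ (i + 1) * ((n + (β - m ^ 2) * R) * X ^ 2) := by positivity
  have e3 : 0 ≤ R ^ (i + 1) * (β * (1 - R) * (R * N - X ^ 2)) := by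
    have : 0 ≤ 1 - R := by linarith
    positivity
  have h2 : R ^ (i + 2) = R ^ (i + 1) * R := pow_succ _ _
  have h3 : R ^ (i + 3) = R ^ (i + 1) * R * R := by rw [pow_succ, h2]
  rw [h2, h3]
  have key : n * (1 - k * (1 - k) / 2) = n + β - 1 + c * q := by rw [hβ]; ring
  rw [key]
  generalize R ^ (i + 1) = Z at *
  nlinarith

/-- For `k < 1` a profile concentrated near the light cone exists. -/
theorem exists_profile {p k : ℝ} (hp : 5 < p) (hk0 : 0 < k) (hk1 : k < 1) :
    ∃ ε v : ℝ, 0 < ε ∧ 0 < v ∧ ∃ e g b h e' g' b' h', Profile p k ε v e g b h e' g' b' h' := by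
  obtain ⟨i, hi⟩ := exists_nat_ge (1 / (1 - k))
  have hki : 1 ≤ i * (1 - k) := by
    rwa [div_le_iff₀ (by linarith)] at hi
  have hi0 : (0 : ℝ) ≤ i := Nat.cast_nonneg i
  obtain ⟨n, hn⟩ : ∃ n : ℝ, n * (2 * i + 7) = 1 := ⟨(2 * i + 7)⁻¹, by field_simp⟩
  obtain ⟨q, hq⟩ : ∃ q : ℝ, q * (2 * i + 9) = 1 := ⟨(2 * i + 9)⁻¹, by field_simp⟩
  have hn0 : 0 < n := by
    by_contra h
    nlinarith [mul_nonneg (sub_nonneg.2 (not_lt.1 h)) hi0]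
  have hq0 : 0 < q := by
    by_contra h
    nlinarith [mul_nonneg (sub_nonneg.2 (not_lt.1 h)) hi0]
  obtain ⟨γ, hγ⟩ : ∃ γ, γ = ((2 - k) * (3 - k) / 2 * q - n * (1 - k * (1 - k) / 2)) / 2 :=
    ⟨_, rfl⟩
  have hγ0 : 0 < γ := by
    have h1 : γ = n * q * ((2 * i + 7) * (2 - 2 * k) - 2 * (1 - k * (1 - k) / 2)) / 2 := by
      rw [hγ]
      linear_combination (-(2 - k) * (3 - k) / 4 * q) * hn + n * (1 - k * (1 - k) / 2) / 2 * hq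
    rw [h1]
    have : 0 < (2 * i + 7) * (2 - 2 * k) - 2 * (1 - k * (1 - k) / 2) := by nlinarith
    positivity
  obtain ⟨δ, hδ⟩ : ∃ δ, δ = γ * (2 / 3) ^ (i + 1) := ⟨_, rfl⟩
  have hδ0 : 0 < δ := by rw [hδ]; positivity
  obtain ⟨ε, hε⟩ : ∃ ε, ε = δ / 30 := ⟨_, rfl⟩
  obtain ⟨v, hv⟩ : ∃ v, v * (p + 3) = δ / 30 :=
    ⟨δ / 30 / (p + 3), div_mul_cancel₀ _ (by linarith)⟩
  have hε0 : 0 < ε := by rw [hε]; positivity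
  have hv0 : 0 < v := by
    by_contra h
    nlinarith
  obtain ⟨s, hs⟩ : ∃ s, s = v * (p + 3) / 6 + ε * k * (k + 1) / 12 := ⟨_, rfl⟩
  have hsδ : s < δ / 15 := by
    rw [hs, hv, hε]
    nlinarith [mul_pos hδ0 hk0, mul_pos hδ0 (sub_pos.2 hk1)]
  obtain ⟨β₀, hβ₀⟩ : ∃ β, β = 1 - k * (1 - k) / 6 - (2 - k) * (3 - k) / 10 := ⟨_, rfl⟩
  obtain ⟨β, hβ⟩ : ∃ β, β = 1 - n * k * (1 - k) / 2 - (2 - k) * (3 - k) / 2 * q := ⟨_, rfl⟩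
  obtain ⟨A, hA⟩ : ∃ A, A = ε * k * (k + 1) / 4 + (p - 1) * v / 2 := ⟨_, rfl⟩
  refine ⟨ε, v, hε0, hv0,
    fun R => (A + δ) + 0 * R + 0 * R ^ (i + 1) + 1 * R ^ (i + 2),
    fun R => δ * ((2 + k) / 3) + 0 * R + 0 * R ^ (i + 1) + (1 - (1 - k) * n) * R ^ (i + 2),
    fun R => (δ / 3 - s) + -(δ * β₀ / 2) * R + (1 - n) / 2 * R ^ (i + 1 + 1)
      + -(β / 2) * R ^ (i + 1 + 2),
    fun R => 3 / 2 * δ * β₀ + 0 * R + (3 * n - 1) / 2 * R ^ (i + 1) + 3 / 2 * β * R ^ (i + 2),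
    _, _, _, _, by fun_prop, by fun_prop, by fun_prop, by fun_prop,
    fun R => hasDerivAt_quadrinomial _ _ _ _ _ R, fun R => hasDerivAt_quadrinomial _ _ _ _ _ R,
    fun R => hasDerivAt_quadrinomial _ _ _ _ _ R, fun R => hasDerivAt_quadrinomial _ _ _ _ _ R,
    fun R => ?_, fun R => ?_, fun R => ?_, fun R ξ N X hR0 hR1 hX hN hne => ?_⟩
  · simp only [pow_succ]
    rw [← hA]
    linear_combination (1 - k) * R ^ i * R * R * hn
  · simp only [pow_succ]
    push_cast
    rw [hβ, hβ₀]
    linear_combination (R ^ i * R + (1 - k) * R ^ i * R ^ 2 * (1 - k / 2)) * hn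
      - (2 - k) * (3 - k) / 2 * R ^ i * R ^ 2 * hq
  · simp only [pow_succ]
    rw [hA, hs]
    ring
  · have h1 := mul_le_mul_of_nonneg_left
      (base_form_lower_bound (ξ := ξ) hk0.le hk1.le hX) hδ0.le
    have h2 := concentrated_form_lower_bound (ξ := ξ) i hk0.le hk1.le hn hq hR0 hR1 hX
    rw [← hβ₀] at h1
    rw [← hβ, ← hγ] at h2
    have hA' : 0 < A - ε * k ^ 2 / 4 := by
      have : A - ε * k ^ 2 / 4 = ε * k / 4 + (p - 1) * v / 2 := by rw [hA]; ring
      rw [this]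
      have : 0 < p - 1 := by linarith
      positivity
    have hC : 0 ≤ R * N - X ^ 2 := by linarith
    have hlow : δ * N / 15 ≤ δ * (N / 3 - X ^ 2 / 5 - 2 / 5 * (R * N - X ^ 2))
        + γ * R ^ (i + 1) * (R * N - X ^ 2) := by
      rcases le_total R (2 / 3) with hR | hR
      · have h3 : 0 ≤ γ * R ^ (i + 1) * (R * N - X ^ 2) := by positivity
        have h4 : N / 15 ≤ N / 3 - X ^ 2 / 5 - 2 / 5 * (R * N - X ^ 2) := by
          have := mul_nonneg (sub_nonneg.2 hR) hN
          linarith [sq_nonneg X]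
        have h5 := mul_le_mul_of_nonneg_left h4 hδ0.le
        linarith
      · have h3 : δ ≤ γ * R ^ (i + 1) := by
          rw [hδ]; gcongr
        have h4 := mul_le_mul_of_nonneg_right h3 hC
        have h5 : N / 15 ≤ N / 3 - X ^ 2 / 5 + 3 / 5 * (R * N - X ^ 2) := by
          have := mul_nonneg (sub_nonneg.2 hR1) hN
          linarith
        have h6 := mul_le_mul_of_nonneg_left h5 hδ0.le
        linarith
    have hpos : 0 < (A - ε * k ^ 2 / 4) * ξ ^ 2 + (δ / 15 - s) * N := by
      rcases hne with h | h
      · have := mul_pos hA' (sq_pos_of_ne_zero h)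
        have := mul_nonneg (sub_nonneg.2 hsδ.le) hN
        linarith
      · have := mul_nonneg hA'.le (sq_nonneg ξ)
        have := mul_pos (sub_pos.2 hsδ) (lt_of_le_of_ne hN (Ne.symm h))
        linarith
    refine lt_of_lt_of_le hpos ?_
    have e3 : i + 1 + 2 = i + 3 := rfl
    have e2 : i + 1 + 1 = i + 2 := rfl
    rw [e2, e3]
    generalize R ^ (i + 1) = Z1 at *
    generalize R ^ (i + 2) = Z2 at *
    generalize R ^ (i + 3) = Z3 at *
    linarith

/-- `f` is differentiable at `y` with `∂_α f = c` there. -/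
def HasPD {d : ℕ} (α : Fin (d + 1)) (f : Sp d → ℝ) (c : ℝ) (y : Sp d) : Prop :=
  DifferentiableAt ℝ f y ∧ pd α f y = c

namespace HasPD

variable {d : ℕ} {α : Fin (d + 1)} {f g : Sp d → ℝ} {a c : ℝ} {y : Sp d}

theorem congr (hf : HasPD α f a y) (h : g =ᶠ[nhds y] f) (hc : a = c) : HasPD α g c y :=
  ⟨hf.1.congr_of_eventuallyEq h, by rw [← hc, ← hf.2]; simp only [pd, h.fderiv_eq]⟩

theorem congr_value (hf : HasPD α f a y) (hc : a = c) : HasPD α f c y := hc ▸ hf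

theorem const (α : Fin (d + 1)) (c : ℝ) (y : Sp d) : HasPD α (fun _ => c) 0 y :=
  ⟨differentiableAt_const c, by simp [pd]⟩

theorem coord (α β : Fin (d + 1)) (y : Sp d) :
    HasPD α (fun z => z β) (if β = α then 1 else 0) y := by
  have h : HasFDerivAt (fun z : Sp d => z β)
      (ContinuousLinearMap.proj β : Sp d →L[ℝ] ℝ) y := hasFDerivAt_apply β y
  exact ⟨h.differentiableAt, by simp [pd, h.fderiv, Pi.single_apply]⟩

theorem add (hf : HasPD α f a y) (hg : HasPD α g c y) :
    HasPD α (fun z => f z + g z) (a + c) y :=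
  ⟨hf.1.add hg.1, by simp [pd, fderiv_fun_add hf.1 hg.1, ← hf.2, ← hg.2]⟩

theorem neg (hf : HasPD α f a y) : HasPD α (fun z => -f z) (-a) y :=
  ⟨hf.1.neg, by simp [pd, ← hf.2]⟩

theorem mul (hf : HasPD α f a y) (hg : HasPD α g c y) :
    HasPD α (fun z => f z * g z) (a * g y + f y * c) y :=
  ⟨hf.1.mul hg.1, by simp [pd, fderiv_fun_mul hf.1 hg.1, ← hf.2, ← hg.2]; ring⟩

theorem comp {φ : ℝ → ℝ} (hφ : HasDerivAt φ c (f y)) (hf : HasPD α f a y) :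
    HasPD α (fun z => φ (f z)) (c * a) y := by
  have h := hφ.comp_hasFDerivAt y hf.1.hasFDerivAt
  refine ⟨h.differentiableAt, ?_⟩
  have h' : fderiv ℝ (fun z => φ (f z)) y = c • fderiv ℝ f y := h.fderiv
  simp [pd, h', ← hf.2]

end HasPD

theorem isOpen_time_pos (d : ℕ) : IsOpen {y : Sp d | 0 < y 0} :=
  isOpen_lt continuous_const (continuous_apply 0)

theorem hasPD_time_rpow {d : ℕ} (α : Fin (d + 1)) (s : ℝ) {y : Sp d} (hy : 0 < y 0) :
    HasPD α (fun z => z 0 ^ s) (s * y 0 ^ (s - 1) * if 0 = α then 1 else 0) y :=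
  HasPD.comp (Real.hasDerivAt_rpow_const (Or.inl hy.ne')) (HasPD.coord α 0 y)

theorem hasPD_time_inv {d : ℕ} (α : Fin (d + 1)) {y : Sp d} (hy : 0 < y 0) :
    HasPD α (fun z => (z 0)⁻¹) (-((y 0)⁻¹ ^ 2) * if 0 = α then 1 else 0) y :=
  (HasPD.comp (hasDerivAt_inv hy.ne') (HasPD.coord α 0 y)).congr_value (by rw [inv_pow])

/-- The self-similar variable `|x|² / t²`. -/
def ratio (y : Sp 3) : ℝ := (∑ i : Fin 3, y i.succ * y i.succ) * ((y 0)⁻¹ * (y 0)⁻¹)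

theorem hasPD_ratio_time {y : Sp 3} (hy : 0 < y 0) :
    HasPD 0 ratio (-2 * ratio y * (y 0)⁻¹) y := by
  have hs (i : Fin 3) := (HasPD.coord 0 i.succ y).mul (HasPD.coord 0 i.succ y)
  have hw := hasPD_time_inv 0 hy
  refine ((((hs 0).add (hs 1)).add (hs 2)).mul (hw.mul hw)).congr ?_ ?_
  · exact Filter.Eventually.of_forall fun z => by simp only [ratio, Fin.sum_univ_three]
  · simp [ratio, Fin.sum_univ_three]
    ring

theorem hasPD_ratio_space (l : Fin 3) {y : Sp 3} (hy : 0 < y 0) :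
    HasPD l.succ ratio (2 * y l.succ * ((y 0)⁻¹ * (y 0)⁻¹)) y := by
  have hs (i : Fin 3) := (HasPD.coord l.succ i.succ y).mul (HasPD.coord l.succ i.succ y)
  have hw := hasPD_time_inv l.succ hy
  refine ((((hs 0).add (hs 1)).add (hs 2)).mul (hw.mul hw)).congr ?_ ?_
  · exact Filter.Eventually.of_forall fun z => by simp only [ratio, Fin.sum_univ_three]
  · fin_cases l <;> simp [Fin.ext_iff, -mul_eq_mul_right_iff] <;> ring

/-- The weight `t ^ (-k-2)`. -/
def weight (k : ℝ) (y : Sp 3) : ℝ := y 0 ^ (-k - 2)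

theorem hasPD_weight_time (k : ℝ) {y : Sp 3} (hy : 0 < y 0) :
    HasPD 0 (weight k) (-(k + 2) * weight k y * (y 0)⁻¹) y :=
  (hasPD_time_rpow 0 (-k - 2) hy).congr_value (by
    rw [Real.rpow_sub_one hy.ne', weight, if_pos rfl]; ring)

theorem hasPD_weight_space (k : ℝ) (l : Fin 3) {y : Sp 3} (hy : 0 < y 0) :
    HasPD l.succ (weight k) 0 y :=
  (hasPD_time_rpow l.succ (-k - 2) hy).congr_value (by simp [(Fin.succ_ne_zero l).symm])

/-- The symmetric tensor field built from the profile functions `e, g, b, h`. -/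
def profileTensor (k : ℝ) (e g b h : ℝ → ℝ) (α β : Fin 4) (y : Sp 3) : ℝ :=
  weight k y * Fin.cases (motive := fun _ => ℝ)
    (Fin.cases (motive := fun _ => ℝ) (e (ratio y))
      (fun m => -((y 0)⁻¹ * y m.succ * g (ratio y))) β)
    (fun l => Fin.cases (motive := fun _ => ℝ) (-((y 0)⁻¹ * y l.succ * g (ratio y)))
      (fun m => (if l = m then 1 else 0) * b (ratio y)
        + (y 0)⁻¹ * (y 0)⁻¹ * (y l.succ * y m.succ) * h (ratio y)) β) α

section profileTensor

variable {k : ℝ} {e g b h e' g' b' h' : ℝ → ℝ}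

theorem profileTensor_symm (α β : Fin 4) :
    profileTensor k e g b h α β = profileTensor k e g b h β α := by
  ext y
  cases α using Fin.cases <;> cases β using Fin.cases <;>
    simp [profileTensor, eq_comm, mul_comm]

theorem profileTensor_trace (y : Sp 3) :
    -profileTensor k e g b h 0 0 y + ∑ i : Fin 3, profileTensor k e g b h i.succ i.succ y =
      weight k y * (-e (ratio y) + 3 * b (ratio y) + ratio y * h (ratio y)) := by
  simp only [profileTensor, Fin.cases_zero, Fin.cases_succ, if_true, Fin.sum_univ_three]
  generalize e (ratio y) = e₀, b (ratio y) = b₀, h (ratio y) = h₀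
  simp only [ratio, Fin.sum_univ_three]
  ring

theorem pd_profileTensor_zero_zero (he : ∀ R, HasDerivAt e (e' R) R) {y : Sp 3} (hy : 0 < y 0) :
    pd 0 (profileTensor k e g b h 0 0) y =
      weight k y * (y 0)⁻¹ * (-(k + 2) * e (ratio y) - 2 * ratio y * e' (ratio y)) :=
  (((hasPD_weight_time k hy).mul (HasPD.comp (he _) (hasPD_ratio_time hy))).congr_value
    (by ring)).2

theorem pd_profileTensor_zero_succ (hg : ∀ R, HasDerivAt g (g' R) R) (l : Fin 3) {y : Sp 3}
    (hy : 0 < y 0) :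
    pd l.succ (profileTensor k e g b h 0 l.succ) y =
      weight k y * (y 0)⁻¹ * (-g (ratio y)
        - 2 * ((y 0)⁻¹ * (y 0)⁻¹ * (y l.succ * y l.succ)) * g' (ratio y)) :=
  (((hasPD_weight_space k l hy).mul ((((hasPD_time_inv l.succ hy).mul
    (HasPD.coord l.succ l.succ y)).mul
      (HasPD.comp (hg _) (hasPD_ratio_space l hy))).neg)).congr_value
        (by simp [(Fin.succ_ne_zero l).symm]; ring)).2

theorem pd_profileTensor_succ_zero (hg : ∀ R, HasDerivAt g (g' R) R) (l : Fin 3) {y : Sp 3}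
    (hy : 0 < y 0) :
    pd 0 (profileTensor k e g b h l.succ 0) y =
      weight k y * ((y 0)⁻¹ * (y 0)⁻¹) * y l.succ *
        ((k + 3) * g (ratio y) + 2 * ratio y * g' (ratio y)) :=
  (((hasPD_weight_time k hy).mul ((((hasPD_time_inv 0 hy).mul
    (HasPD.coord 0 l.succ y)).mul
      (HasPD.comp (hg _) (hasPD_ratio_time hy))).neg)).congr_value
        (by simp; ring)).2

theorem pd_profileTensor_succ_succ (hb : ∀ R, HasDerivAt b (b' R) R)
    (hh : ∀ R, HasDerivAt h (h' R) R) (l m : Fin 3) {y : Sp 3} (hy : 0 < y 0) :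
    pd m.succ (profileTensor k e g b h l.succ m.succ) y =
      weight k y * ((y 0)⁻¹ * (y 0)⁻¹) *
        ((if l = m then 2 * y m.succ * b' (ratio y) + y m.succ * h (ratio y) else 0)
          + y l.succ * h (ratio y)
          + 2 * ((y 0)⁻¹ * (y 0)⁻¹ * (y m.succ * y m.succ)) * y l.succ * h' (ratio y)) := by
  have hw := hasPD_time_inv m.succ hy
  have hc (i : Fin 3) := HasPD.coord m.succ i.succ y
  have hR := hasPD_ratio_space m hy
  refine (((hasPD_weight_space k m hy).mul
    (((HasPD.const m.succ (if l = m then 1 else 0) y).mul (HasPD.comp (hb _) hR)).add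
      (((hw.mul hw).mul ((hc l).mul (hc m))).mul (HasPD.comp (hh _) hR)))).congr_value ?_).2
  by_cases hlm : l = m
  · simp [hlm, (Fin.succ_ne_zero m).symm]; ring
  · simp [hlm, (Fin.succ_ne_zero m).symm]; ring

theorem contDiffOn_ratio : ContDiffOn ℝ (⊤ : ℕ∞) ratio {y | 0 < y 0} := by
  have hw : ContDiffOn ℝ (⊤ : ℕ∞) (fun y : Sp 3 => (y 0)⁻¹) {y | 0 < y 0} :=
    ContDiffOn.inv (by fun_prop) fun y hy => ne_of_gt hy
  exact ContDiffOn.mul (by fun_prop) (hw.mul hw)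

theorem contDiffOn_time_rpow (s : ℝ) :
    ContDiffOn ℝ (⊤ : ℕ∞) (fun y : Sp 3 => y 0 ^ s) {y | 0 < y 0} :=
  ContDiffOn.rpow_const_of_ne (by fun_prop) fun y hy => ne_of_gt hy

theorem contDiffOn_profileTensor (he : ContDiff ℝ (⊤ : ℕ∞) e) (hg : ContDiff ℝ (⊤ : ℕ∞) g)
    (hb : ContDiff ℝ (⊤ : ℕ∞) b) (hh : ContDiff ℝ (⊤ : ℕ∞) h) (α β : Fin 4) :
    ContDiffOn ℝ (⊤ : ℕ∞) (profileTensor k e g b h α β) {y | 0 < y 0} := by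
  have hw : ContDiffOn ℝ (⊤ : ℕ∞) (fun y : Sp 3 => (y 0)⁻¹) {y | 0 < y 0} :=
    ContDiffOn.inv (by fun_prop) fun y hy => ne_of_gt hy
  have hx (i : Fin 4) : ContDiffOn ℝ (⊤ : ℕ∞) (fun y : Sp 3 => y i) {y | 0 < y 0} := by fun_prop
  have hc {f : ℝ → ℝ} (hf : ContDiff ℝ (⊤ : ℕ∞) f) :
      ContDiffOn ℝ (⊤ : ℕ∞) (fun y : Sp 3 => f (ratio y)) {y | 0 < y 0} :=
    hf.comp_contDiffOn contDiffOn_ratio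
  refine (contDiffOn_time_rpow (-k - 2)).mul ?_
  cases α using Fin.cases with
  | zero =>
    cases β using Fin.cases with
    | zero => exact hc he
    | succ m => exact ((hw.mul (hx m.succ)).mul (hc hg)).neg
  | succ l =>
    cases β using Fin.cases with
    | zero => exact ((hw.mul (hx l.succ)).mul (hc hg)).neg
    | succ m =>
      exact (contDiffOn_const.mul (hc hb)).add
        (((hw.mul hw).mul ((hx l.succ).mul (hx m.succ))).mul (hc hh))

theorem time_rpow_smul (s S : ℝ) {y : Sp 3} (hy : 0 < y 0) :
    (Real.exp S • y) 0 ^ s = Real.exp (s * S) * y 0 ^ s := by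
  rw [Pi.smul_apply, smul_eq_mul, Real.mul_rpow (Real.exp_pos S).le hy.le, ← Real.exp_mul,
    mul_comm S s]

theorem profileTensor_smul (S : ℝ) (α β : Fin 4) {y : Sp 3} (hy : 0 < y 0) :
    profileTensor k e g b h α β (Real.exp S • y) =
      Real.exp ((-k - 2) * S) * profileTensor k e g b h α β y := by
  have hS := (Real.exp_pos S).ne'
  have hinv (i : Fin 4) : ((Real.exp S • y) 0)⁻¹ * (Real.exp S • y) i = (y 0)⁻¹ * y i := by
    simp only [Pi.smul_apply, smul_eq_mul]
    field_simp
  have hinv2 (i j : Fin 4) : ((Real.exp S • y) 0)⁻¹ * ((Real.exp S • y) 0)⁻¹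
      * ((Real.exp S • y) i * (Real.exp S • y) j) = (y 0)⁻¹ * (y 0)⁻¹ * (y i * y j) := by
    rw [mul_mul_mul_comm, hinv, hinv]; ring
  have hR : ratio (Real.exp S • y) = ratio y := by
    simp only [ratio, Finset.sum_mul, mul_comm (_ * _) (((_ : ℝ))⁻¹ * _), hinv2]
  have hP : weight k (Real.exp S • y) = Real.exp ((-k - 2) * S) * weight k y :=
    time_rpow_smul _ _ hy
  unfold profileTensor
  rw [hP, hR, mul_assoc]
  simp only [hinv, hinv2]

end profileTensor

theorem dAlembert_time_rpow (ε k : ℝ) {y : Sp 3} (hy : 0 < y 0) :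
    dAlembert (fun z : Sp 3 => ε * z 0 ^ (-k)) y = -(ε * k * (k + 1)) * weight k y := by
  have hU := (isOpen_time_pos 3).mem_nhds hy
  have h1 (α : Fin 4) {z : Sp 3} (hz : 0 < z 0) :=
    (HasPD.const α ε z).mul (hasPD_time_rpow α (-k) hz)
  have h2 : HasPD 0 (pd 0 fun z : Sp 3 => ε * z 0 ^ (-k)) (ε * k * (k + 1) * weight k y) y := by
    refine ((HasPD.const 0 (-(ε * k)) y).mul (hasPD_time_rpow 0 (-k - 1) hy)).congr ?_ ?_
    · filter_upwards [hU] with z hz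
      rw [(h1 0 hz).2, if_pos rfl]; ring
    · rw [weight, if_pos rfl, show -k - 1 - 1 = -k - 2 by ring]; ring
  have h3 (i : Fin 3) : HasPD i.succ (pd i.succ fun z : Sp 3 => ε * z 0 ^ (-k)) 0 y := by
    refine (HasPD.const i.succ 0 y).congr ?_ rfl
    filter_upwards [hU] with z hz
    rw [(h1 i.succ hz).2, if_neg (Fin.succ_ne_zero i).symm]; ring
  simp only [dAlembert, h2.2, (h3 _).2, Finset.sum_const_zero]
  ring

/-- The quadratic form of `bigMat` for `M = ε t ^ (-k)` and a profile tensor. -/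
theorem bigMat_quadratic_form (ε k : ℝ) (e g b h : ℝ → ℝ) {y : Sp 3} (ht : 0 < y 0)
    (x : Fin 5 → ℝ) :
    star x ⬝ᵥ Matrix.mulVec
        (bigMat (fun z : Sp 3 => ε * z 0 ^ (-k)) (profileTensor k e g b h) y) x =
      weight k y * (ε * (y 0 * x 0 - k / 2 * x 1) ^ 2
        + ((e (ratio y) - ε * k ^ 2 / 4) * x 1 ^ 2
          - 2 * g (ratio y) * x 1 * ((y 0)⁻¹ * (y 1 * x 2 + y 2 * x 3 + y 3 * x 4))
          + b (ratio y) * (x 2 ^ 2 + x 3 ^ 2 + x 4 ^ 2)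
          + h (ratio y) * ((y 0)⁻¹ * (y 1 * x 2 + y 2 * x 3 + y 3 * x 4)) ^ 2)) := by
  have hM : y 0 ^ (-k) = weight k y * (y 0 * y 0) := by
    rw [weight, Real.rpow_sub ht, Real.rpow_two]; field_simp
  have hpd (α : Fin 4) := ((HasPD.const α ε y).mul (hasPD_time_rpow α (-k) ht)).2
  have hpd0 : pd 0 (fun z : Sp 3 => ε * z 0 ^ (-k)) y = -(ε * k) * (weight k y * y 0) := by
    rw [hpd, if_pos rfl, Real.rpow_sub_one ht.ne', hM]; field_simp; ring
  have hpds (i : Fin 3) : pd i.succ (fun z : Sp 3 => ε * z 0 ^ (-k)) y = 0 := by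
    rw [hpd, if_neg (Fin.succ_ne_zero i).symm]; ring
  have h2 : (3 : Fin 4) = Fin.succ 2 := rfl
  have h1 : (2 : Fin 4) = Fin.succ 1 := rfl
  have h0 : (1 : Fin 4) = Fin.succ 0 := rfl
  have hE00 : profileTensor k e g b h 0 0 y = weight k y * e (ratio y) := rfl
  have hE0 (m : Fin 3) : profileTensor k e g b h 0 m.succ y =
      weight k y * -((y 0)⁻¹ * y m.succ * g (ratio y)) := rfl
  have hEs0 (m : Fin 3) : profileTensor k e g b h m.succ 0 y =
      weight k y * -((y 0)⁻¹ * y m.succ * g (ratio y)) := rfl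
  have hE (l m : Fin 3) : profileTensor k e g b h l.succ m.succ y =
      weight k y * ((if l = m then 1 else 0) * b (ratio y)
        + (y 0)⁻¹ * (y 0)⁻¹ * (y l.succ * y m.succ) * h (ratio y)) := rfl
  simp [bigMat, dotProduct, Matrix.mulVec, Fin.sum_univ_succ]
  rw [h2, h1, h0]
  simp only [hpds, hpd0, hE00, hE0, hEs0, hE, hM]
  generalize e (ratio y) = e₀, g (ratio y) = g₀, b (ratio y) = b₀, h (ratio y) = h₀
  simp [← h0, ← h1, ← h2]
  ring

theorem Profile.posDef_bigMat {p k ε v : ℝ} {e g b h e' g' b' h' : ℝ → ℝ}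
    (H : Profile p k ε v e g b h e' g' b' h') (hε : 0 < ε) {y : Sp 3} (hy : y ∈ Cone 3) :
    (bigMat (fun z : Sp 3 => ε * z 0 ^ (-k)) (profileTensor k e g b h) y).PosDef := by
  obtain ⟨ht, hcone⟩ := hy
  have hP : 0 < weight k y := Real.rpow_pos_of_pos ht _
  refine Matrix.PosDef.of_dotProduct_mulVec_pos ?_ fun x hx => ?_
  · ext i j
    cases i using Fin.cases <;> cases j using Fin.cases <;>
      simp [bigMat, Fin.succ_ne_zero, profileTensor_symm]
  have hR0 : 0 ≤ ratio y := by
    unfold ratio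
    exact mul_nonneg (Finset.sum_nonneg fun i _ => mul_self_nonneg _) (mul_self_nonneg _)
  have hR1 : ratio y ≤ 1 := by
    have : ratio y * (y 0 ^ 2) = ∑ i : Fin 3, y i.succ ^ 2 := by
      simp only [ratio, pow_two]; field_simp
    have h0 : 0 < y 0 ^ 2 := by positivity
    nlinarith
  obtain ⟨N, hN⟩ : ∃ N, N = x 2 ^ 2 + x 3 ^ 2 + x 4 ^ 2 := ⟨_, rfl⟩
  obtain ⟨X, hX⟩ : ∃ X, X = (y 0)⁻¹ * (y 1 * x 2 + y 2 * x 3 + y 3 * x 4) := ⟨_, rfl⟩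
  have hXN : X ^ 2 ≤ ratio y * N := by
    have : ratio y * N - X ^ 2 = (y 0)⁻¹ ^ 2 * ((y 1 * x 3 - y 2 * x 2) ^ 2
        + (y 1 * x 4 - y 3 * x 2) ^ 2 + (y 2 * x 4 - y 3 * x 3) ^ 2) := by
      simp only [ratio, hN, hX, Fin.sum_univ_three, Fin.succ_zero_eq_one, Fin.succ_one_eq_two,
        show Fin.succ (2 : Fin 3) = 3 from rfl]
      ring
    have h0 : 0 ≤ ratio y * N - X ^ 2 := by rw [this]; positivity
    linarith
  have hN0 : 0 ≤ N := by rw [hN]; positivity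
  have key := bigMat_quadratic_form ε k e g b h ht x
  rw [← hN, ← hX] at key
  rw [key]
  refine mul_pos hP ?_
  by_cases hne : x 1 ≠ 0 ∨ N ≠ 0
  · have := H.pos _ _ _ _ hR0 hR1 hXN hN0 hne
    positivity
  · push Not at hne
    obtain ⟨h1, h2⟩ := hne
    rw [hN] at h2
    have h22 : x 2 = 0 := pow_eq_zero_iff two_ne_zero |>.1 (by
      linarith [sq_nonneg (x 2), sq_nonneg (x 3), sq_nonneg (x 4)])
    have h33 : x 3 = 0 := pow_eq_zero_iff two_ne_zero |>.1 (by
      linarith [sq_nonneg (x 2), sq_nonneg (x 3), sq_nonneg (x 4)])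
    have h44 : x 4 = 0 := pow_eq_zero_iff two_ne_zero |>.1 (by
      linarith [sq_nonneg (x 2), sq_nonneg (x 3), sq_nonneg (x 4)])
    have h00 : x 0 ≠ 0 := by
      intro h0
      refine hx (funext fun i => ?_)
      fin_cases i <;> assumption
    have hX0 : X = 0 := by rw [hX, h22, h33, h44]; ring
    rw [h1, hN, h2, hX0]
    have : 0 < ε * (y 0 * x 0) ^ 2 := by positivity
    simpa using this

/-- Theorem 4.1, third reduction.  For `d = 3` and `p > 5` there exist
`S > 0` and smooth fields `M, E_{αβ}` on `Γ₃`, discretely self-similar, obeying the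
defocusing inequality and the divergence equations, with the `5×5` matrix strictly
positive definite on `Γ₃`. -/
theorem stmt6 (p : ℝ) (hp : 5 < p) :
    ∃ S : ℝ, 0 < S ∧
    ∃ (M : Sp 3 → ℝ) (E : Fin 4 → Fin 4 → Sp 3 → ℝ) (Ω : Set (Sp 3)),
      IsOpen Ω ∧ Cone 3 ⊆ Ω ∧
      ContDiffOn ℝ (⊤ : ℕ∞) M Ω ∧ (∀ α β, ContDiffOn ℝ (⊤ : ℕ∞) (E α β) Ω) ∧
      -- symmetry
      (∀ α β, E α β = E β α) ∧
      -- discrete self-similarity (i)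
      (∀ y ∈ Cone 3, M (Real.exp S • y) = Real.exp (-(4 / (p - 1)) * S) * M y) ∧
      (∀ α β, ∀ y ∈ Cone 3,
        E α β (Real.exp S • y) = Real.exp (-(2 * (p + 1) / (p - 1)) * S) * E α β y) ∧
      -- defocusing condition (ii)
      (∀ y ∈ Cone 3,
        0 < (1 / 2) * dAlembert M y - (-(E 0 0 y) + ∑ i : Fin 3, E i.succ i.succ y)) ∧
      -- divergence equations (iii)
      (∀ α : Fin 4, ∀ y ∈ Cone 3,
        pd α (fun z =>
            (1 / 2) * dAlembert M z - (-(E 0 0 z) + ∑ i : Fin 3, E i.succ i.succ z)) y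
          = (p + 1) * (-(pd 0 (E α 0) y) + (∑ i : Fin 3, pd i.succ (E α i.succ) y)
              - (1 / 2) * pd α (fun z => -(E 0 0 z) + ∑ i : Fin 3, E i.succ i.succ z) y)) ∧
      -- positive definiteness (iv)
      (∀ y ∈ Cone 3, (bigMat M E y).PosDef) := by
  have hp1 : 0 < p - 1 := by linarith
  obtain ⟨k, hk⟩ : ∃ k, k = 4 / (p - 1) := ⟨_, rfl⟩
  have hk0 : 0 < k := by rw [hk]; positivity
  have hk1 : k < 1 := by rw [hk, div_lt_one hp1]; linarith
  obtain ⟨ε, v, hε, hv, e, g, b, h, e', g', b', h', H⟩ := exists_profile hp hk0 hk1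
  have htrace (z : Sp 3) : -profileTensor k e g b h 0 0 z
      + ∑ i : Fin 3, profileTensor k e g b h i.succ i.succ z
        = -(ε * k * (k + 1) / 2 + (p + 1) * v) * weight k z := by
    rw [profileTensor_trace, H.trace, mul_comm]
  have hpot {z : Sp 3} (hz : 0 < z 0) :
      1 / 2 * dAlembert (fun z : Sp 3 => ε * z 0 ^ (-k)) z
        - (-profileTensor k e g b h 0 0 z + ∑ i : Fin 3, profileTensor k e g b h i.succ i.succ z)
        = (p + 1) * v * weight k z := by
    rw [htrace, dAlembert_time_rpow ε k hz]; ring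
  refine ⟨1, one_pos, fun z => ε * z 0 ^ (-k), profileTensor k e g b h, {y | 0 < y 0},
    isOpen_time_pos 3, fun y hy => hy.1, contDiffOn_const.mul (contDiffOn_time_rpow (-k)),
    contDiffOn_profileTensor H.smooth_e H.smooth_g H.smooth_b H.smooth_h, profileTensor_symm,
    fun y hy => ?_, fun α β y hy => ?_, fun y hy => ?_, fun α y hy => ?_,
    fun y hy => H.posDef_bigMat hε hy⟩
  · simp only [time_rpow_smul (-k) 1 hy.1, ← hk]; ring
  · rw [profileTensor_smul 1 α β hy.1]
    congr 2
    rw [hk]; field_simp; ring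
  · rw [hpot hy.1]
    have : 0 < weight k y := Real.rpow_pos_of_pos hy.1 _
    have : 0 < p + 1 := by linarith
    positivity
  · have ht := hy.1
    have hev : (fun z => 1 / 2 * dAlembert (fun z : Sp 3 => ε * z 0 ^ (-k)) z
        - (-profileTensor k e g b h 0 0 z + ∑ i : Fin 3, profileTensor k e g b h i.succ i.succ z))
        =ᶠ[nhds y] fun z => (p + 1) * v * weight k z := by
      filter_upwards [(isOpen_time_pos 3).mem_nhds ht] with z hz using hpot hz
    have hscale {c a : ℝ} (ha : HasPD α (weight k) a y) :=
      (HasPD.const α c y).mul ha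
    simp only [htrace] at hev ⊢
    cases α using Fin.cases with
    | zero =>
      have hP := hasPD_weight_time k ht
      rw [((hscale hP).congr hev rfl).2, (hscale hP).2,
        pd_profileTensor_zero_zero H.deriv_e ht]
      simp only [pd_profileTensor_zero_succ H.deriv_g _ ht, Fin.sum_univ_three]
      have hsum : (y 0)⁻¹ * (y 0)⁻¹ * (y (Fin.succ 0) * y (Fin.succ 0))
          + (y 0)⁻¹ * (y 0)⁻¹ * (y (Fin.succ 1) * y (Fin.succ 1))
          + (y 0)⁻¹ * (y 0)⁻¹ * (y (Fin.succ 2) * y (Fin.succ 2)) = ratio y := by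
        simp only [ratio, Fin.sum_univ_three]; ring
      linear_combination (-(p + 1) * weight k y * (y 0)⁻¹) * H.energy (ratio y)
        + 2 * (p + 1) * weight k y * (y 0)⁻¹ * g' (ratio y) * hsum
    | succ l =>
      have hP := hasPD_weight_space k l ht
      rw [((hscale hP).congr hev rfl).2, (hscale hP).2,
        pd_profileTensor_succ_zero H.deriv_g l ht]
      simp only [pd_profileTensor_succ_succ H.deriv_b H.deriv_h _ _ ht, Finset.sum_add_distrib, ← Finset.mul_sum,
        ← Finset.sum_mul, Finset.sum_ite_eq, Finset.mem_univ, if_true, Finset.sum_const]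
      have hsum : (y 0)⁻¹ * (y 0)⁻¹ * ∑ i : Fin 3, y i.succ * y i.succ = ratio y := by
        rw [ratio, mul_comm]
      rw [hsum]
      simp only [Finset.card_univ, Fintype.card_fin, nsmul_eq_mul]
      push_cast
      linear_combination (-(p + 1) * weight k y * ((y 0)⁻¹ * (y 0)⁻¹) * y l.succ)
        * H.momentum (ratio y)
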